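/- Let μ be a finite nonnegative Borel measure on ℝ with Fourier transform μ̂. Let λ > 0, γ > 0, ζ ≥ 0 and θ ≥ 0 with λ(1+ζ)/γ − 1 > 1/2 and λθ/γ > 1/2, and let c > 0, δ > 0, C > 0 and ξ₀ ≥ 0 be constants. Suppose that for every ξ with |ξ| ≥ ξ₀ and every ε ∈ (0,1): |μ̂(ξ)| ≤ exp(−c δ^λ ε |ξ|^λ) + C|ξ| ε^{(1+ζ)/γ} + C ε^{θ/γ}. Then ∫_ℝ |μ̂(ξ)|² dξ < ∞, and consequently μ is absolutely continuous with respect to Lebesgue measure. -/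

import Mathlib

open MeasureTheory

/-- The Fourier transform of a finite nonnegative Borel measure on `ℝ`:
`μ̂(ξ) = ∫ e^{iξx} μ(dx)`. -/
noncomputable def fourierOfMeasure (μ : Measure ℝ) (ξ : ℝ) : ℂ :=
  ∫ x, Complex.exp (Complex.I * ξ * x) ∂μ

lemma fourierOfMeasure_eq_charFun (μ : Measure ℝ) : fourierOfMeasure μ = charFun μ := by
  ext ξ
  simp only [fourierOfMeasure, charFun_apply_real]
  congr with x
  ring_nf

section Decay

open Real Filter Asymptotics

lemma isBigO_exp_neg_mul_rpow_atTop {k η : ℝ} (hk : 0 < k) (hη : 0 < η) (s : ℝ) :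
    (fun x : ℝ ↦ exp (-(k * x ^ η))) =O[atTop] fun x ↦ x ^ s := by
  have h := ((isLittleO_exp_neg_mul_rpow_atTop hk (s / η)).isBigO).comp_tendsto
    (tendsto_rpow_atTop hη)
  refine h.congr' (.of_forall fun x ↦ by simp) ?_
  filter_upwards [eventually_ge_atTop 0] with x hx
  simp only [Function.comp_apply]
  rw [← rpow_mul hx, mul_div_cancel₀ _ hη.ne']

lemma isBigO_rpow_rpow_atTop_of_le {a b : ℝ} (hab : a ≤ b) :
    (fun x : ℝ ↦ x ^ a) =O[atTop] fun x ↦ x ^ b := by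
  refine .of_bound' ?_
  filter_upwards [eventually_ge_atTop 1] with x hx
  rw [norm_of_nonneg (by positivity), norm_of_nonneg (by positivity)]
  exact rpow_le_rpow_of_exponent_le hx hab

/-- Choosing `ε = x ^ (-t)` with `t < lam` close to `lam` turns a family of bounds indexed by
`ε ∈ (0, 1)` into a power decay that is square integrable at infinity. -/
lemma exists_isBigO_rpow_of_forall_exp_bound {g : ℝ → ℝ} {lam a b k C x₀ : ℝ}
    (hg : ∀ x, 0 ≤ g x) (ha : 0 < a) (hb : 0 ≤ b)
    (h₁ : 1 / 2 < lam * a - 1) (h₂ : 1 / 2 < lam * b) (hk : 0 < k)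
    (h : ∀ x, x₀ ≤ x → 0 ≤ x → ∀ ε ∈ Set.Ioo (0 : ℝ) 1,
      g x ≤ exp (-(k * ε * x ^ lam)) + C * x * ε ^ a + C * ε ^ b) :
    ∃ s : ℝ, 1 / 2 < s ∧ g =O[atTop] fun x ↦ x ^ (-s) := by
  have hb' : 0 < b := hb.lt_of_ne fun h ↦ by subst h; norm_num at h₂
  obtain ⟨t, ht, htlam⟩ : ∃ t, max (3 / 2 / a) (1 / 2 / b) < t ∧ t < lam := by
    refine exists_between (max_lt ?_ ?_)
    · rw [div_lt_iff₀ ha]; linarith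
    · rwa [div_lt_iff₀ hb']
  obtain ⟨hta, htb⟩ := max_lt_iff.1 ht
  have ht₀ : 0 < t := lt_trans (by positivity) hta
  rw [div_lt_iff₀ ha] at hta
  rw [div_lt_iff₀ hb'] at htb
  refine ⟨min (t * a - 1) (t * b), lt_min (by linarith) htb, ?_⟩
  set s := min (t * a - 1) (t * b)
  have hO : (fun x : ℝ ↦ exp (-(k * x ^ (lam - t))) + C * x ^ (-(t * a - 1))
      + C * x ^ (-(t * b))) =O[atTop] fun x ↦ x ^ (-s) :=
    ((isBigO_exp_neg_mul_rpow_atTop hk (sub_pos.2 htlam) _).add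
      ((isBigO_rpow_rpow_atTop_of_le (neg_le_neg (min_le_left _ _))).const_mul_left C)).add
      ((isBigO_rpow_rpow_atTop_of_le (neg_le_neg (min_le_right _ _))).const_mul_left C)
  refine IsBigO.trans (.of_bound' ?_) hO
  filter_upwards [eventually_gt_atTop 1, eventually_ge_atTop x₀] with x hx hx₀
  have hx' : 0 < x := by linarith
  rw [norm_of_nonneg (hg x)]
  refine (h x hx₀ hx'.le (x ^ (-t))
    ⟨by positivity, rpow_lt_one_of_one_lt_of_neg hx (by linarith)⟩).trans (le_trans (le_of_eq ?_)
    (le_norm_self _))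
  have e₁ : k * x ^ (-t) * x ^ lam = k * x ^ (lam - t) := by
    rw [mul_assoc, ← rpow_add hx']; ring_nf
  have e₂ : C * x * (x ^ (-t)) ^ a = C * x ^ (-(t * a - 1)) := by
    rw [← rpow_mul hx'.le, mul_assoc, ← rpow_one_add' hx'.le (by linarith)]; ring_nf
  rw [e₁, e₂, ← rpow_mul hx'.le, neg_mul]

end Decay

lemma integrable_norm_charFun_sq_of_isBigO {μ : Measure ℝ} [IsFiniteMeasure μ] {s : ℝ}
    (hs : 1 / 2 < s) (h : charFun μ =O[Filter.atTop] fun x ↦ x ^ (-s)) :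
    Integrable fun ξ ↦ ‖charFun μ ξ‖ ^ 2 := by
  have hloc : LocallyIntegrable fun ξ ↦ ‖charFun μ ξ‖ ^ 2 :=
    (continuous_charFun.norm.pow 2).locallyIntegrable
  refine hloc.integrable_of_isBigO_atTop_of_norm_isNegInvariant
    (g := fun x ↦ x ^ (-(2 * s))) (.of_forall fun x ↦ by simp [charFun_neg]) ?_
    (integrableAtFilter_rpow_atTop_iff.2 (by linarith))
  refine (h.norm_left.pow 2).congr' .rfl ?_
  filter_upwards [Filter.eventually_ge_atTop 0] with x hx
  rw [← Real.rpow_mul_natCast hx]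
  ring_nf

section AbsolutelyContinuous

open FourierTransform SchwartzMap Real
open scoped ContDiff

/-- Parseval's formula for a finite measure against a Schwartz function. -/
lemma integral_charFun_mul_eq_integral_fourier (μ : Measure ℝ) [IsFiniteMeasure μ]
    (ψ : 𝓢(ℝ, ℂ)) :
    ∫ ξ, charFun μ (-(2 * π) * ξ) * ψ ξ = ∫ x, 𝓕 ψ x ∂μ := by
  have h := VectorFourier.integral_fourierIntegral_smul_eq_flip (μ := μ) (ν := volume)
    (L := innerₗ ℝ) (f := 1) (g := ψ) continuous_fourierChar continuous_inner
    (integrable_const _) ψ.integrable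
  simp only [charFun_eq_fourierIntegral', smul_eq_mul] at h ⊢
  rw [Pi.one_def] at h
  simp only [one_mul, flip_innerₗ] at h
  refine Eq.trans (integral_congr_ae (.of_forall fun ξ ↦ ?_))
    (h.trans (integral_congr_ae (.of_forall fun x ↦ (congrFun (fourier_coe ψ) x).symm)))
  have : -(2 * π)⁻¹ * (-(2 * π) * ξ) = ξ := by field_simp
  simp only [this, Pi.one_def]

lemma norm_integral_le_of_integrable_charFun_sq (μ : Measure ℝ) [IsFiniteMeasure μ]
    (hμ : Integrable fun ξ ↦ ‖charFun μ ξ‖ ^ 2) (φ : 𝓢(ℝ, ℂ)) :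
    ‖∫ x, φ x ∂μ‖ ≤ (∫ ξ, ‖charFun μ (-(2 * π) * ξ)‖ ^ 2) ^ (1 / 2 : ℝ)
      * (∫ x, ‖φ x‖ ^ 2) ^ (1 / 2 : ℝ) := by
  have hF : MemLp (fun ξ ↦ charFun μ (-(2 * π) * ξ)) 2 := by
    refine (memLp_two_iff_integrable_sq_norm ?_).2 (hμ.comp_mul_left' (by simp [pi_ne_zero]))
    exact (continuous_charFun.comp (by fun_prop)).aestronglyMeasurable
  have hφ : 𝓕 (𝓕⁻ φ) = φ := FourierTransform.fourier_fourierInv_eq φ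
  have hCS := integral_mul_norm_le_Lp_mul_Lq (μ := volume) Real.HolderConjugate.two_two
    (by simpa using hF) (by simpa using (𝓕⁻ φ).memLp 2)
  have hP := SchwartzMap.integral_norm_sq_fourier (𝓕⁻ φ)
  rw [hφ] at hP
  rw [hP]
  calc ‖∫ x, φ x ∂μ‖ = ‖∫ ξ, charFun μ (-(2 * π) * ξ) * 𝓕⁻ φ ξ‖ := by
        rw [integral_charFun_mul_eq_integral_fourier, hφ]
    _ ≤ ∫ ξ, ‖charFun μ (-(2 * π) * ξ)‖ * ‖𝓕⁻ φ ξ‖ := by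
        simpa using norm_integral_le_integral_norm
          (fun ξ ↦ charFun μ (-(2 * π) * ξ) * 𝓕⁻ φ ξ)
    _ ≤ _ := by simpa using hCS

lemma measureReal_le_of_isCompact_of_subset_isOpen (μ : Measure ℝ) [IsFiniteMeasure μ]
    (hμ : Integrable fun ξ ↦ ‖charFun μ ξ‖ ^ 2) {K U : Set ℝ} (hK : IsCompact K)
    (hU : IsOpen U) (hKU : K ⊆ U) (hUfin : volume U ≠ ⊤) :
    μ.real K ≤ (∫ ξ, ‖charFun μ (-(2 * π) * ξ)‖ ^ 2) ^ (1 / 2 : ℝ)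
      * (volume.real U) ^ (1 / 2 : ℝ) := by
  obtain ⟨L, hL, hKL, hLU⟩ := exists_compact_between hK hU hKU
  obtain ⟨f, hf₁, hf₀, hf⟩ := exists_contMDiffMap_one_nhds_of_subset_interior
    (n := ⊤) (modelWithCornersSelf ℝ ℝ) hK.isClosed hKL
  have hfK : ∀ x ∈ K, f x = 1 := fun x hx ↦ hf₁.self_of_nhdsSet x hx
  let g : ℝ → ℂ := fun x ↦ (f x : ℂ)
  have hgsupp : HasCompactSupport g := .intro hL fun x hx ↦ by simp [g, hf₀ x hx]
  have hgsmooth : ContDiff ℝ ∞ g := Complex.ofRealCLM.contDiff.comp f.contMDiff.contDiff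
  let φ : 𝓢(ℝ, ℂ) := hgsupp.toSchwartzMap hgsmooth
  have hφ : ∀ x, φ x = (f x : ℂ) := fun x ↦ rfl
  have hcont : Continuous f := f.contMDiff.continuous
  have hint : Integrable f μ := .of_bound hcont.aestronglyMeasurable 1
    (.of_forall fun x ↦ (norm_of_nonneg (hf x).1).trans_le (hf x).2)
  have hlower : μ.real K ≤ ‖∫ x, φ x ∂μ‖ := by
    simp only [hφ, integral_complex_ofReal, Complex.norm_real]
    refine le_trans ?_ (le_norm_self _)
    rw [← integral_indicator_one hK.measurableSet]
    refine integral_mono ((integrable_const 1).indicator hK.measurableSet) hint fun x ↦ ?_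
    by_cases hx : x ∈ K
    · simp [hx, hfK x hx]
    · simpa [hx] using (hf x).1
  have hupper : ∫ x, ‖φ x‖ ^ 2 ≤ volume.real U := by
    rw [← integral_indicator_one hU.measurableSet]
    refine integral_mono_of_nonneg (.of_forall fun x ↦ by positivity)
      ((integrable_indicator_iff hU.measurableSet).2 (integrableOn_const hUfin))
      (.of_forall fun x ↦ ?_)
    simp only [hφ, Complex.norm_real, norm_eq_abs, sq_abs]
    by_cases hx : x ∈ U
    · simpa [hx, abs_of_nonneg (hf x).1] using (hf x).2
    · simp [hx, hf₀ x fun h ↦ hx (hLU h)]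
  refine hlower.trans ((norm_integral_le_of_integrable_charFun_sq μ hμ φ).trans ?_)
  gcongr

/-- A finite measure on `ℝ` with square integrable characteristic function is absolutely
continuous with respect to Lebesgue measure. -/
lemma absolutelyContinuous_of_integrable_charFun_sq (μ : Measure ℝ) [IsFiniteMeasure μ]
    (hμ : Integrable fun ξ ↦ ‖charFun μ ξ‖ ^ 2) : μ ≪ volume := by
  refine .mk fun s hs hs₀ ↦ ?_
  rw [hs.measure_eq_iSup_isCompact_of_ne_top (measure_ne_top μ s)]
  simp only [ENNReal.iSup_eq_zero]
  intro K hKs hK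
  rw [← measureReal_eq_zero_iff]
  refine le_antisymm ?_ measureReal_nonneg
  set A := (∫ ξ, ‖charFun μ (-(2 * π) * ξ)‖ ^ 2) ^ (1 / 2 : ℝ)
  have hA₀ : 0 ≤ A := by positivity
  have hbound : ∀ ε : ℝ, 0 < ε → μ.real K ≤ A * ε ^ (1 / 2 : ℝ) := by
    intro ε hε
    obtain ⟨U, hKU, hU, hUε⟩ := K.exists_isOpen_lt_of_lt (ENNReal.ofReal ε)
      (by rw [measure_mono_null hKs hs₀]; simpa using hε)
    have hUfin : volume U ≠ ⊤ := hUε.ne_top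
    refine (measureReal_le_of_isCompact_of_subset_isOpen μ hμ hK hU hKU hUfin).trans ?_
    gcongr
    exact ENNReal.toReal_le_of_le_ofReal hε.le hUε.le
  have hlim : Filter.Tendsto (fun ε : ℝ ↦ A * ε ^ (1 / 2 : ℝ)) (nhdsWithin 0 (Set.Ioi 0))
      (nhds 0) := by
    have : Continuous fun ε : ℝ ↦ A * ε ^ (1 / 2 : ℝ) :=
      continuous_const.mul (continuous_id.rpow_const fun _ ↦ .inr (by norm_num))
    simpa using (this.tendsto 0).mono_left nhdsWithin_le_nhds
  exact ge_of_tendsto hlim (Filter.eventually_of_mem self_mem_nhdsWithin hbound)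

end AbsolutelyContinuous

/-- If a finite nonnegative Borel measure `μ` on `ℝ` satisfies, for parameters
`λ, γ > 0`, `ζ, θ ≥ 0` with `λ(1+ζ)/γ - 1 > 1/2` and `λθ/γ > 1/2`, and constants `c > 0`,
`δ > 0`, `C > 0`, `ξ₀ ≥ 0`, the bound
`|μ̂(ξ)| ≤ exp(-c δ^λ ε |ξ|^λ) + C |ξ| ε^{(1+ζ)/γ} + C ε^{θ/γ}`
for every `|ξ| ≥ ξ₀` and every `ε ∈ (0,1)`, then `∫ |μ̂(ξ)|² dξ < ∞` and consequently `μ`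
is absolutely continuous with respect to Lebesgue measure. -/
theorem integrable_sq_fourier_and_absolutelyContinuous_levy
    (μ : Measure ℝ) [IsFiniteMeasure μ] (lam γ ζ θ c δ C ξ₀ : ℝ)
    (hlam : 0 < lam) (hγ : 0 < γ) (hζ : 0 ≤ ζ) (hθ : 0 ≤ θ)
    (hcond1 : 1 / 2 < lam * (1 + ζ) / γ - 1) (hcond2 : 1 / 2 < lam * θ / γ)
    (hc : 0 < c) (hδ : 0 < δ) (hC : 0 < C) (hξ₀ : 0 ≤ ξ₀)
    (h : ∀ ξ : ℝ, ξ₀ ≤ |ξ| → ∀ ε ∈ Set.Ioo (0 : ℝ) 1,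
      ‖fourierOfMeasure μ ξ‖
        ≤ Real.exp (-(c * δ ^ lam * ε * |ξ| ^ lam)) + C * |ξ| * ε ^ ((1 + ζ) / γ)
          + C * ε ^ (θ / γ)) :
    Integrable (fun ξ : ℝ => ‖fourierOfMeasure μ ξ‖ ^ 2) ∧ μ ≪ volume := by
  rw [fourierOfMeasure_eq_charFun] at h ⊢
  have ha : 0 < (1 + ζ) / γ := by positivity
  obtain ⟨s, hs, hO⟩ := exists_isBigO_rpow_of_forall_exp_bound (g := fun ξ ↦ ‖charFun μ ξ‖)
    (k := c * δ ^ lam) (C := C) (x₀ := ξ₀) (fun _ ↦ norm_nonneg _) ha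
    (div_nonneg hθ hγ.le) (by rwa [← mul_div_assoc]) (by rwa [← mul_div_assoc])
    (by positivity) fun x hx hx₀ ε hε ↦ by
      simpa only [abs_of_nonneg hx₀] using h x (by rwa [abs_of_nonneg hx₀]) ε hε
  have hint := integrable_norm_charFun_sq_of_isBigO hs hO.of_norm_left
  exact ⟨hint, absolutelyContinuous_of_integrable_charFun_sq μ hint⟩
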